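/- For every x ∈ ℚ_p⁴ and every t > 0, ∂Z(x,t)/∂t = −κ (f(∂,α)Z_t)(x); that is, the heat kernel solves the equation ∂Z/∂t + κ f(∂,α)Z = 0 for t > 0. -/

import Mathlib

open MeasureTheory Real Filter Set

noncomputable section

namespace PadicParabolic

variable (p : ℕ) [Fact p.Prime]

instance : MeasurableSpace ℚ_[p] := borel _
instance : BorelSpace ℚ_[p] := ⟨rfl⟩

/-- The four dimensional vector space over `ℚ_[p]`, with the max-norm
`‖x‖ = max_{1 ≤ i ≤ 4} |x_i|_p`. -/
abbrev V (p : ℕ) [Fact p.Prime] := Fin 4 → ℚ_[p]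

/-- `a` is a quadratic non-residue modulo `p`. -/
def IsQNR (a : ℤ) : Prop := ∀ b : ZMod p, b ^ 2 ≠ (a : ZMod p)

/-- The elliptic quadratic form `f(x) = x₁² − a x₂² − p x₃² + a p x₄²`. -/
def qf (a : ℤ) (x : V p) : ℚ_[p] :=
  x 0 ^ 2 - (a : ℚ_[p]) * x 1 ^ 2 - (p : ℚ_[p]) * x 2 ^ 2 + (a : ℚ_[p]) * (p : ℚ_[p]) * x 3 ^ 2

/-- The dual elliptic quadratic form `f°(ξ) = a p ξ₁² − p ξ₂² − a ξ₃² + ξ₄²`. -/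
def qfc (a : ℤ) (x : V p) : ℚ_[p] :=
  (a : ℚ_[p]) * (p : ℚ_[p]) * x 0 ^ 2 - (p : ℚ_[p]) * x 1 ^ 2 - (a : ℚ_[p]) * x 2 ^ 2 + x 3 ^ 2

/-- `χ` is the standard additive character `χ(y) = exp(2πi {y}_p)` of `ℚ_p`, characterized as
the unique continuous function with `χ(m/pⁿ) = exp(2πi m/pⁿ)`. -/
def IsStdChar (χ : ℚ_[p] → ℂ) : Prop :=
  Continuous χ ∧ ∀ (m : ℤ) (n : ℕ),
    χ ((m : ℚ_[p]) / (p : ℚ_[p]) ^ n) =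
      Complex.exp (2 * (Real.pi : ℂ) * Complex.I * (m : ℂ) / (p : ℂ) ^ n)

/-- The heat kernel `Z(x,t) = ∫_{ℚ_p⁴} χ(ξ·x) e^{−κ t |f°(ξ)|_p^α} d⁴ξ`. -/
def heatZ (μ : Measure (V p)) (χ : ℚ_[p] → ℂ) (a : ℤ) (κ α : ℝ) (x : V p) (t : ℝ) : ℂ :=
  ∫ ξ, χ (∑ i, ξ i * x i) * (Real.exp (-(κ * t * ‖qfc p a ξ‖ ^ α)) : ℂ) ∂μ

/-- The pseudodifferential operator
`(f(∂,γ)φ)(x) = ((1 − p^γ)/(1 − p^{−γ−2})) ∫ (φ(x−y) − φ(x)) |f(y)|_p^{−γ−2} d⁴y`. -/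
def fop (μ : Measure (V p)) (a : ℤ) (γ : ℝ) (φ : V p → ℂ) (x : V p) : ℂ :=
  (((1 - (p : ℝ) ^ γ) / (1 - (p : ℝ) ^ (-γ - 2)) : ℝ) : ℂ) *
    ∫ y, (φ (x - y) - φ x) * ((‖qf p a y‖ ^ (-γ - 2) : ℝ) : ℂ) ∂μ

/-- Membership in the domain of `f(∂,γ)`: `φ` is locally constant and
`∫_{‖x‖_p ≥ p^m} |φ(x)| |f(x)|_p^{−γ−2} d⁴x < ∞` for some `m ∈ ℤ`. -/
def InDomain (μ : Measure (V p)) (a : ℤ) (γ : ℝ) (φ : V p → ℂ) : Prop :=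
  IsLocallyConstant φ ∧ ∃ m : ℤ,
    IntegrableOn (fun x => ‖φ x‖ * ‖qf p a x‖ ^ (-γ - 2)) {x : V p | (p : ℝ) ^ m ≤ ‖x‖} μ

lemma one_lt_cast : (1 : ℝ) < p := by exact_mod_cast (Fact.out : p.Prime).one_lt

lemma cast_pos : (0 : ℝ) < p := by exact_mod_cast (Fact.out : p.Prime).pos

lemma norm_cast_prime : ‖(p : ℚ_[p])‖ = (p : ℝ)⁻¹ := by simp

/-- A nonresidue is a `p`-adic unit, and so is `u² - a` for every `p`-adic integer `u`. -/
lemma norm_sq_sub_eq_one {a : ℤ} (ha : IsQNR p a) {u : ℚ_[p]} (hu : ‖u‖ ≤ 1) :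
    ‖u ^ 2 - (a : ℚ_[p])‖ = 1 := by
  let v : ℤ_[p] := ⟨u, hu⟩
  have h : ‖v ^ 2 - (a : ℤ_[p])‖ = 1 := by
    refine le_antisymm (PadicInt.norm_le_one _) (not_lt.1 fun hlt => ?_)
    have hm : v ^ 2 - (a : ℤ_[p]) ∈ IsLocalRing.maximalIdeal ℤ_[p] := by
      rwa [IsLocalRing.mem_maximalIdeal, PadicInt.mem_nonunits]
    rw [← PadicInt.ker_toZMod, RingHom.mem_ker, map_sub, map_pow, map_intCast, sub_eq_zero] at hm
    exact ha _ hm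
  rw [PadicInt.norm_def] at h
  push_cast at h
  exact h

lemma norm_nonresidue {a : ℤ} (ha : IsQNR p a) : ‖(a : ℚ_[p])‖ = 1 := by
  simpa using norm_sq_sub_eq_one p ha (u := 0) (by simp)

lemma norm_binary_form {a : ℤ} (ha : IsQNR p a) (x y : ℚ_[p]) :
    ‖x ^ 2 - (a : ℚ_[p]) * y ^ 2‖ = max ‖x‖ ‖y‖ ^ 2 := by
  rcases lt_or_ge ‖y‖ ‖x‖ with h | h
  · have h1 : ‖(a : ℚ_[p]) * y ^ 2‖ < ‖x ^ 2‖ := by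
      rw [norm_mul, norm_nonresidue p ha, one_mul, norm_pow, norm_pow]
      gcongr
    rw [max_eq_left h.le, sub_eq_add_neg, IsUltrametricDist.norm_add_eq_max_of_norm_ne_norm
      (by rw [norm_neg]; exact h1.ne'), norm_neg, max_eq_left h1.le, norm_pow]
  · rw [max_eq_right h]
    rcases eq_or_ne y 0 with rfl | hy
    · have : x = 0 := by simpa using h
      simp [this]
    · have hu : ‖x / y‖ ≤ 1 := by
        rw [norm_div]; exact div_le_one_of_le₀ h (norm_nonneg _)
      have : x ^ 2 - (a : ℚ_[p]) * y ^ 2 = ((x / y) ^ 2 - a) * y ^ 2 := by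
        field_simp
      rw [this, norm_mul, norm_sq_sub_eq_one p ha hu, one_mul, norm_pow]

lemma exists_zpow_eq_max_norm {x y : ℚ_[p]} (h : max ‖x‖ ‖y‖ ≠ 0) :
    ∃ n : ℤ, max ‖x‖ ‖y‖ = (p : ℝ) ^ n := by
  rcases max_cases ‖x‖ ‖y‖ with ⟨e, -⟩ | ⟨e, -⟩ <;> rw [e] at h ⊢
  · exact ⟨_, Padic.norm_eq_zpow_neg_valuation (norm_ne_zero_iff.1 h)⟩
  · exact ⟨_, Padic.norm_eq_zpow_neg_valuation (norm_ne_zero_iff.1 h)⟩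

lemma norm_qf {a : ℤ} (ha : IsQNR p a) (x : V p) :
    ‖qf p a x‖ = max (max ‖x 0‖ ‖x 1‖ ^ 2) ((p : ℝ)⁻¹ * max ‖x 2‖ ‖x 3‖ ^ 2) := by
  have e : qf p a x = (x 0 ^ 2 - (a : ℚ_[p]) * x 1 ^ 2) +
      -((p : ℚ_[p]) * (x 2 ^ 2 - (a : ℚ_[p]) * x 3 ^ 2)) := by
    unfold qf; ring
  have e1 := norm_binary_form p ha (x 0) (x 1)
  have e2 : ‖-((p : ℚ_[p]) * (x 2 ^ 2 - (a : ℚ_[p]) * x 3 ^ 2))‖ =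
      (p : ℝ)⁻¹ * max ‖x 2‖ ‖x 3‖ ^ 2 := by
    rw [norm_neg, norm_mul, norm_binary_form p ha, norm_cast_prime]
  rcases eq_or_ne (max ‖x 2‖ ‖x 3‖) 0 with h2 | h2
  · have : -((p : ℚ_[p]) * (x 2 ^ 2 - (a : ℚ_[p]) * x 3 ^ 2)) = 0 := by
      rw [← norm_eq_zero, e2, h2]; simp
    rw [e, this, add_zero, e1, h2]
    simp
  rw [e, IsUltrametricDist.norm_add_eq_max_of_norm_ne_norm, e1, e2]
  rw [e1, e2]
  obtain ⟨n, hn⟩ := exists_zpow_eq_max_norm p h2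
  rw [hn]
  rcases eq_or_ne (max ‖x 0‖ ‖x 1‖) 0 with h1 | h1
  · rw [h1]
    have := cast_pos p
    refine ne_of_lt ?_
    rw [zero_pow two_ne_zero]
    positivity
  obtain ⟨m, hm⟩ := exists_zpow_eq_max_norm p h1
  rw [hm]
  have hp0 : (p : ℝ) ≠ 0 := (cast_pos p).ne'
  have l : ((p : ℝ) ^ m) ^ 2 = (p : ℝ) ^ (2 * m) := by
    rw [mul_comm, zpow_mul]; norm_cast
  have r : (p : ℝ)⁻¹ * ((p : ℝ) ^ n) ^ 2 = (p : ℝ) ^ (2 * n - 1) := by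
    rw [zpow_sub_one₀ hp0, mul_comm 2 n, zpow_mul, mul_comm]; norm_cast
  rw [l, r]
  intro h
  have := zpow_right_injective₀ (cast_pos p) (one_lt_cast p).ne' h
  omega

lemma norm_qf_eq_zpow {a : ℤ} {x : V p} (h : ‖qf p a x‖ ≠ 0) :
    ∃ n : ℤ, ‖qf p a x‖ = (p : ℝ) ^ n :=
  ⟨_, Padic.norm_eq_zpow_neg_valuation (norm_ne_zero_iff.1 h)⟩

lemma qfc_eq_qf_comp_rev (a : ℤ) (x : V p) : qfc p a x = qf p a (x ∘ Fin.rev) := by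
  have h0 : Fin.rev (0 : Fin 4) = 3 := rfl
  have h1 : Fin.rev (1 : Fin 4) = 2 := rfl
  have h2 : Fin.rev (2 : Fin 4) = 1 := rfl
  have h3 : Fin.rev (3 : Fin 4) = 0 := rfl
  simp only [qf, qfc, Function.comp, h0, h1, h2, h3]
  ring

lemma norm_qfc {a : ℤ} (ha : IsQNR p a) (x : V p) :
    ‖qfc p a x‖ = max ((p : ℝ)⁻¹ * max ‖x 0‖ ‖x 1‖ ^ 2) (max ‖x 2‖ ‖x 3‖ ^ 2) := by
  rw [qfc_eq_qf_comp_rev, norm_qf p ha, max_comm]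
  change max (_ * max ‖x 1‖ ‖x 0‖ ^ 2) (max ‖x 3‖ ‖x 2‖ ^ 2) = _
  rw [max_comm ‖x 1‖, max_comm ‖x 3‖]

lemma norm_qf_le_iff {a : ℤ} (ha : IsQNR p a) (x : V p) (r : ℝ) :
    ‖qf p a x‖ ≤ r ↔ (‖x 0‖ ^ 2 ≤ r ∧ ‖x 1‖ ^ 2 ≤ r) ∧
      ((p : ℝ)⁻¹ * ‖x 2‖ ^ 2 ≤ r ∧ (p : ℝ)⁻¹ * ‖x 3‖ ^ 2 ≤ r) := by
  have hsq (u v : ℚ_[p]) : max ‖u‖ ‖v‖ ^ 2 = max (‖u‖ ^ 2) (‖v‖ ^ 2) := by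
    rcases le_total ‖u‖ ‖v‖ with h | h
    · rw [max_eq_right h, max_eq_right (by gcongr)]
    · rw [max_eq_left h, max_eq_left (by gcongr)]
  rw [norm_qf p ha, hsq, hsq, mul_max_of_nonneg _ _ (by positivity), max_le_iff, max_le_iff,
    max_le_iff]

lemma qf_neg (a : ℤ) (x : V p) : qf p a (-x) = qf p a x := by simp [qf]

lemma qfc_neg (a : ℤ) (x : V p) : qfc p a (-x) = qfc p a x := by simp [qfc]

lemma norm_qf_add_le {a : ℤ} (ha : IsQNR p a) {x y : V p} {r : ℝ} (hx : ‖qf p a x‖ ≤ r)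
    (hy : ‖qf p a y‖ ≤ r) : ‖qf p a (x + y)‖ ≤ r := by
  have key (u v : ℚ_[p]) (c : ℝ) (hc : 0 ≤ c) (hu : c * ‖u‖ ^ 2 ≤ r) (hv : c * ‖v‖ ^ 2 ≤ r) :
      c * ‖u + v‖ ^ 2 ≤ r := by
    rcases le_max_iff.1 (Padic.nonarchimedean u v) with h | h
    · exact le_trans (by gcongr) hu
    · exact le_trans (by gcongr) hv
  have key1 (u v : ℚ_[p]) (hu : ‖u‖ ^ 2 ≤ r) (hv : ‖v‖ ^ 2 ≤ r) : ‖u + v‖ ^ 2 ≤ r := by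
    simpa using key u v 1 zero_le_one (by simpa) (by simpa)
  rw [norm_qf_le_iff p ha] at hx hy ⊢
  have hp := inv_nonneg.2 (cast_pos p).le
  exact ⟨⟨key1 _ _ hx.1.1 hy.1.1, key1 _ _ hx.1.2 hy.1.2⟩,
    ⟨key _ _ _ hp hx.2.1 hy.2.1, key _ _ _ hp hx.2.2 hy.2.2⟩⟩

/-- The duality inequality between `f` and `f°`. -/
lemma norm_dot_le_one {a : ℤ} (ha : IsQNR p a) {x y : V p} {n : ℤ}
    (hx : ‖qfc p a x‖ ≤ (p : ℝ) ^ n) (hy : ‖qf p a y‖ ≤ (p : ℝ) ^ (-n)) :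
    ‖∑ i, x i * y i‖ ≤ 1 := by
  have hp1 := one_lt_cast p
  have hp0 := cast_pos p
  have key (u v : ℚ_[p]) (c d : ℝ) (hc : 0 < c) (hd : 0 < d) (hcd : c * d = (p : ℝ)⁻¹)
      (hu : c * ‖u‖ ^ 2 ≤ (p : ℝ) ^ n) (hv : d * ‖v‖ ^ 2 ≤ (p : ℝ) ^ (-n)) : ‖u * v‖ ≤ 1 := by
    have h : (c * ‖u‖ ^ 2) * (d * ‖v‖ ^ 2) ≤ (p : ℝ) ^ n * (p : ℝ) ^ (-n) := by gcongr
    rw [← zpow_add₀ hp0.ne', add_neg_cancel, zpow_zero] at h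
    have h2 : ‖u * v‖ ^ 2 ≤ p := by
      have : (c * ‖u‖ ^ 2) * (d * ‖v‖ ^ 2) = (p : ℝ)⁻¹ * ‖u * v‖ ^ 2 := by
        rw [← hcd, norm_mul]; ring
      rw [this, inv_mul_le_iff₀ hp0, mul_one] at h
      exact h
    rw [← zpow_zero (p : ℝ), Padic.norm_le_pow_iff_norm_lt_pow_add_one, zero_add, zpow_one]
    nlinarith [norm_nonneg (u * v)]
  rw [qfc_eq_qf_comp_rev, norm_qf_le_iff p ha] at hx
  rw [norm_qf_le_iff p ha] at hy
  obtain ⟨⟨h3, h2⟩, h1, h0⟩ := hx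
  obtain ⟨⟨k0, k1⟩, k2, k3⟩ := hy
  have hpi := inv_pos.2 hp0
  refine IsUltrametricDist.norm_sum_le_of_forall_le_of_nonneg zero_le_one fun i _ => ?_
  fin_cases i
  · exact key _ _ _ 1 hpi one_pos (by simp) h0 (by simpa using k0)
  · exact key _ _ _ 1 hpi one_pos (by simp) h1 (by simpa using k1)
  · exact key _ _ 1 _ one_pos hpi (by simp) (by simpa using h2) k2
  · exact key _ _ 1 _ one_pos hpi (by simp) (by simpa using h3) k3

lemma norm_qf_single {a : ℤ} (ha : IsQNR p a) (i : Fin 4) (u : ℚ_[p]) :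
    ‖qf p a (Pi.single i u)‖ = (if i < 2 then 1 else (p : ℝ)⁻¹) * ‖u‖ ^ 2 := by
  have hp : (0 : ℝ) ≤ (p : ℝ)⁻¹ * ‖u‖ ^ 2 := by positivity
  rw [norm_qf p ha]
  fin_cases i <;> simp [hp]

lemma exists_dot_eq_inv {a : ℤ} (ha : IsQNR p a) {x : V p} {n : ℤ}
    (hx : (p : ℝ) ^ n < ‖qfc p a x‖) :
    ∃ y : V p, ‖qf p a y‖ ≤ (p : ℝ) ^ (-n) ∧ ∑ i, x i * y i = (p : ℚ_[p])⁻¹ := by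
  have hp0 := cast_pos p
  have hx' : (p : ℝ) ^ (n + 1) ≤ ‖qfc p a x‖ := by
    by_contra! h
    exact absurd ((Padic.norm_le_pow_iff_norm_lt_pow_add_one _ _).2 h) (not_le.2 hx)
  have key (i : Fin 4) (c : ℝ) (hc : (if i < 2 then 1 else (p : ℝ)⁻¹) * c = (p : ℝ)⁻¹)
      (hi : ‖qfc p a x‖ = c * ‖x i‖ ^ 2) :
      ∃ y : V p, ‖qf p a y‖ ≤ (p : ℝ) ^ (-n) ∧ ∑ i, x i * y i = (p : ℚ_[p])⁻¹ := by
    have hpos : 0 < c * ‖x i‖ ^ 2 := hi ▸ lt_trans (by positivity) hx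
    have hxi : x i ≠ 0 := by
      rintro h
      simp [h] at hpos
    have hc0 : c ≠ 0 := by
      rintro rfl
      simp at hpos
    refine ⟨Pi.single i ((p : ℚ_[p])⁻¹ * (x i)⁻¹), ?_, ?_⟩
    · rw [norm_qf_single p ha, norm_mul, norm_inv, norm_inv, norm_cast_prime, inv_inv]
      have e : (if i < 2 then 1 else (p : ℝ)⁻¹) * ((p : ℝ) * ‖x i‖⁻¹) ^ 2 =
          p * (‖qfc p a x‖)⁻¹ := by
        rw [hi, eq_div_of_mul_eq hc0 hc]
        have := norm_ne_zero_iff.2 hxi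
        field_simp
      rw [e, ← div_eq_mul_inv, div_le_iff₀ (lt_trans (by positivity) hx)]
      calc (p : ℝ) = (p : ℝ) ^ (-n) * (p : ℝ) ^ (n + 1) := by
            rw [← zpow_add₀ hp0.ne']; simp
        _ ≤ _ := by gcongr
    · rw [Finset.sum_eq_single i]
      · rw [Pi.single_eq_same]; field_simp
      · intro j _ hj; simp [hj]
      · simp
  have hq := norm_qfc p ha x
  rcases max_choice ((p : ℝ)⁻¹ * max ‖x 0‖ ‖x 1‖ ^ 2) (max ‖x 2‖ ‖x 3‖ ^ 2) with h | h <;>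
    rw [h] at hq
  · rcases max_choice ‖x 0‖ ‖x 1‖ with h | h <;> rw [h] at hq
    · exact key 0 _ (by simp) hq
    · exact key 1 _ (by simp) hq
  · rcases max_choice ‖x 2‖ ‖x 3‖ with h | h <;> rw [h] at hq
    · exact key 2 1 (by simp) (by simpa using hq)
    · exact key 3 1 (by simp) (by simpa using hq)

open scoped ENNReal

lemma denseRange_int_div_pow : DenseRange fun q : ℤ × ℕ => (q.1 : ℚ_[p]) / (p : ℚ_[p]) ^ q.2 := by
  refine Metric.denseRange_iff.2 fun x ε hε => ?_
  have hp0 := cast_pos p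
  have hpp : (p : ℚ_[p]) ≠ 0 := by exact_mod_cast (Fact.out : p.Prime).ne_zero
  obtain ⟨n, hn⟩ := pow_unbounded_of_one_lt ‖x‖ (one_lt_cast p)
  have hv : ‖x * (p : ℚ_[p]) ^ n‖ ≤ 1 := by
    rw [norm_mul, norm_pow, norm_cast_prime, inv_pow]
    exact mul_inv_le_one_of_le₀ hn.le (by positivity)
  let v : ℤ_[p] := ⟨x * (p : ℚ_[p]) ^ n, hv⟩
  obtain ⟨m, hm⟩ := (PadicInt.denseRange_intCast (p := p)).exists_dist_lt v
    (ε := ε / (p : ℝ) ^ n) (by positivity)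
  refine ⟨(m, n), ?_⟩
  rw [dist_eq_norm, PadicInt.norm_def] at hm
  push_cast at hm
  change ‖x * (p : ℚ_[p]) ^ n - m‖ < _ at hm
  have e : x - (m : ℚ_[p]) / (p : ℚ_[p]) ^ n =
      (x * (p : ℚ_[p]) ^ n - m) / (p : ℚ_[p]) ^ n := by
    field_simp
  rw [dist_eq_norm, e, norm_div, norm_pow, norm_cast_prime, inv_pow, div_inv_eq_mul]
  rwa [lt_div_iff₀ (by positivity)] at hm

section Character

variable {p} {χ : ℚ_[p] → ℂ}

lemma IsStdChar.map_add (hχ : IsStdChar p χ) (x y : ℚ_[p]) : χ (x + y) = χ x * χ y := by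
  have hc := hχ.1
  have hpp : (p : ℚ_[p]) ≠ 0 := by exact_mod_cast (Fact.out : p.Prime).ne_zero
  have hpc : (p : ℂ) ≠ 0 := by exact_mod_cast (Fact.out : p.Prime).ne_zero
  refine congr_fun (((denseRange_int_div_pow p).prodMap (denseRange_int_div_pow p)).equalizer
    (show Continuous fun q : ℚ_[p] × ℚ_[p] => χ (q.1 + q.2) by fun_prop)
    (show Continuous fun q : ℚ_[p] × ℚ_[p] => χ q.1 * χ q.2 by fun_prop) (funext ?_)) (x, y)
  rintro ⟨⟨m, n⟩, ⟨m', n'⟩⟩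
  have e : (m : ℚ_[p]) / (p : ℚ_[p]) ^ n + (m' : ℚ_[p]) / (p : ℚ_[p]) ^ n' =
      ((m * (p : ℤ) ^ n' + m' * (p : ℤ) ^ n : ℤ) : ℚ_[p]) / (p : ℚ_[p]) ^ (n + n') := by
    push_cast
    field_simp
    ring
  simp only [Function.comp_apply, Prod.map_apply]
  rw [e, hχ.2, hχ.2, hχ.2, ← Complex.exp_add]
  congr 1
  push_cast
  field_simp
  ring

lemma IsStdChar.norm_eq_one (hχ : IsStdChar p χ) (x : ℚ_[p]) : ‖χ x‖ = 1 := by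
  refine congr_fun ((denseRange_int_div_pow p).equalizer hχ.1.norm
    (continuous_const (y := (1 : ℝ))) (funext ?_)) x
  rintro ⟨m, n⟩
  simp only [Function.comp_apply]
  rw [hχ.2, show 2 * (Real.pi : ℂ) * Complex.I * (m : ℂ) / (p : ℂ) ^ n =
    ((2 * Real.pi * m / (p : ℝ) ^ n : ℝ) : ℂ) * Complex.I by push_cast; ring,
    Complex.norm_exp_ofReal_mul_I]

lemma IsStdChar.eq_one_of_norm_le_one (hχ : IsStdChar p χ) {x : ℚ_[p]} (hx : ‖x‖ ≤ 1) :
    χ x = 1 := by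
  refine congr_fun ((PadicInt.denseRange_intCast (p := p)).equalizer
    (hχ.1.comp continuous_subtype_val) (continuous_const (y := (1 : ℂ)))
    (funext fun m => ?_)) ⟨x, hx⟩
  have := hχ.2 m 0
  simp only [pow_zero, div_one] at this
  change χ ((m : ℤ_[p]) : ℚ_[p]) = 1
  rw [PadicInt.coe_intCast, this, mul_comm, Complex.exp_int_mul_two_pi_mul_I]

lemma IsStdChar.inv_prime_ne_one (hχ : IsStdChar p χ) : χ (p : ℚ_[p])⁻¹ ≠ 1 := by
  have h := hχ.2 1 1
  simp only [Int.cast_one, pow_one, one_div, mul_one] at h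
  rw [h, Ne, Complex.exp_eq_one_iff]
  rintro ⟨n, hn⟩
  have hpc : (p : ℂ) ≠ 0 := by exact_mod_cast (Fact.out : p.Prime).ne_zero
  have h1 : (1 : ℂ) = n * p := by
    have := Complex.two_pi_I_ne_zero
    field_simp at hn
    simpa [mul_comm] using hn
  have h2 : (1 : ℤ) = n * p := by exact_mod_cast h1
  have := Int.isUnit_iff.1 (IsUnit.of_mul_eq_one _ ((mul_comm _ _).trans h2.symm))
  have := (Fact.out : p.Prime).one_lt
  omega

end Character

lemma continuous_qf (a : ℤ) : Continuous (qf p a) := by unfold qf; fun_prop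

lemma continuous_qfc (a : ℤ) : Continuous (qfc p a) := by unfold qfc; fun_prop

/-- The balls `{y : |f(y)|_p ≤ r}`. -/
def qball (a : ℤ) (r : ℝ) : Set (V p) := {y | ‖qf p a y‖ ≤ r}

lemma measurableSet_qball (a : ℤ) (r : ℝ) : MeasurableSet (qball p a r) :=
  (isClosed_le (continuous_qf p a).norm continuous_const).measurableSet

lemma qball_one {a : ℤ} (ha : IsQNR p a) : qball p a 1 = {x : V p | ‖x‖ ≤ 1} := by
  have hp0 := cast_pos p
  have key (u : ℚ_[p]) : (p : ℝ)⁻¹ * ‖u‖ ^ 2 ≤ 1 ↔ ‖u‖ ≤ 1 := by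
    rw [inv_mul_le_iff₀ hp0, mul_one]
    constructor
    · intro h
      rw [← zpow_zero (p : ℝ), Padic.norm_le_pow_iff_norm_lt_pow_add_one, zero_add, zpow_one]
      nlinarith [norm_nonneg u, one_lt_cast p]
    · intro h
      nlinarith [norm_nonneg u, one_lt_cast p]
  ext y
  rw [qball, mem_ofPred_eq, mem_ofPred_eq, norm_qf_le_iff p ha, key, key,
    pi_norm_le_iff_of_nonneg zero_le_one]
  simp [Fin.forall_fin_succ, and_assoc]

lemma mem_qball_inv {a : ℤ} (ha : IsQNR p a) (y : V p) :
    y ∈ qball p a (p : ℝ)⁻¹ ↔ (‖y 0‖ < 1 ∧ ‖y 1‖ < 1) ∧ ‖y 2‖ ≤ 1 ∧ ‖y 3‖ ≤ 1 := by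
  have hp0 := cast_pos p
  have hp1 := one_lt_cast p
  have h2 (u : ℚ_[p]) : (p : ℝ)⁻¹ * ‖u‖ ^ 2 ≤ (p : ℝ)⁻¹ ↔ ‖u‖ ≤ 1 := by
    rw [mul_le_iff_le_one_right (by positivity)]
    exact sq_le_one_iff₀ (norm_nonneg _)
  have h1 (u : ℚ_[p]) : ‖u‖ ^ 2 ≤ (p : ℝ)⁻¹ ↔ ‖u‖ < 1 := by
    constructor
    · intro h
      have := inv_lt_one_of_one_lt₀ hp1
      exact (sq_lt_one_iff₀ (norm_nonneg _)).1 (h.trans_lt this)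
    · intro h
      have h' : ‖u‖ ≤ (p : ℝ) ^ (-1 : ℤ) := by
        rw [Padic.norm_le_pow_iff_norm_lt_pow_add_one]; simpa using h
      rw [zpow_neg_one] at h'
      nlinarith [norm_nonneg u]
  rw [qball, mem_ofPred_eq, norm_qf_le_iff p ha, h1, h1, h2, h2]

/-- The similitude `(y₁, y₂, y₃, y₄) ↦ (p y₃, p y₄, y₁, y₂)` of `f`, with multiplier `-p`. -/
def shift : V p ≃ₜ+ V p where
  toFun y := ![p * y 2, p * y 3, y 0, y 1]
  invFun y := ![y 2, y 3, (p : ℚ_[p])⁻¹ * y 0, (p : ℚ_[p])⁻¹ * y 1]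
  left_inv y := by
    have hpp : (p : ℚ_[p]) ≠ 0 := by exact_mod_cast (Fact.out : p.Prime).ne_zero
    ext i; fin_cases i <;> simp [hpp]
  right_inv y := by
    have hpp : (p : ℚ_[p]) ≠ 0 := by exact_mod_cast (Fact.out : p.Prime).ne_zero
    ext i; fin_cases i <;> simp [hpp]
  map_add' x y := by ext i; fin_cases i <;> simp [mul_add]
  continuous_toFun := by
    refine continuous_pi fun i => ?_
    fin_cases i <;> simp <;> fun_prop
  continuous_invFun := by
    refine continuous_pi fun i => ?_
    fin_cases i <;> simp <;> fun_prop

lemma qf_shift (a : ℤ) (y : V p) : qf p a (shift p y) = -(p * qf p a y) := by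
  change qf p a ![p * y 2, p * y 3, y 0, y 1] = _
  simp only [qf, Matrix.cons_val_zero, Matrix.cons_val_one, Matrix.cons_val]
  ring

lemma shift_preimage_qball (a : ℤ) (r : ℝ) :
    shift p ⁻¹' qball p a r = qball p a (p * r) := by
  ext y
  rw [mem_preimage, qball, qball, mem_ofPred_eq, mem_ofPred_eq, qf_shift, norm_neg, norm_mul,
    norm_cast_prime, inv_mul_le_iff₀ (cast_pos p)]

section Measure

variable (μ : Measure (V p)) [μ.IsAddHaarMeasure]

lemma exists_measure_qball_mul (a : ℤ) :
    ∃ c : ℝ≥0∞, ∀ r : ℝ, μ (qball p a (p * r)) = c * μ (qball p a r) := by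
  have := (shift p).isAddHaarMeasure_map μ
  refine ⟨((μ.map (shift p)).addHaarScalarFactor μ : ℝ≥0∞), fun r => ?_⟩
  have h := Measure.isAddLeftInvariant_eq_smul (μ.map (shift p)) μ
  have h2 := congr_arg (fun ν : Measure (V p) => ν (qball p a r)) h
  rw [Measure.map_apply (show Measurable (shift p) from (shift p).continuous.measurable)
      (measurableSet_qball p a r), shift_preimage_qball] at h2
  rw [h2]
  rfl

lemma measure_qball_one_eq {a : ℤ} (ha : IsQNR p a) :
    μ (qball p a 1) = (p : ℝ≥0∞) ^ 2 * μ (qball p a (p : ℝ)⁻¹) := by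
  let v : Fin p × Fin p → V p := fun q => ![((q.1 : ℕ) : ℚ_[p]), ((q.2 : ℕ) : ℚ_[p]), 0, 0]
  have hU : qball p a 1 = ⋃ q : Fin p × Fin p, (fun y => -v q + y) ⁻¹' qball p a (p : ℝ)⁻¹ := by
    ext y
    rw [qball_one p ha, mem_ofPred_eq, pi_norm_le_iff_of_nonneg zero_le_one, mem_iUnion]
    constructor
    · intro h
      obtain ⟨n0, l0, h0⟩ := PadicInt.exists_mem_range (⟨y 0, h 0⟩ : ℤ_[p])
      obtain ⟨n1, l1, h1⟩ := PadicInt.exists_mem_range (⟨y 1, h 1⟩ : ℤ_[p])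
      rw [IsLocalRing.mem_maximalIdeal, PadicInt.mem_nonunits, PadicInt.norm_def] at h0 h1
      refine ⟨(⟨n0, l0⟩, ⟨n1, l1⟩), ?_⟩
      rw [mem_preimage, mem_qball_inv p ha]
      simp only [v, neg_add_eq_sub, Pi.sub_apply, Matrix.cons_val_zero, Matrix.cons_val_one,
        Matrix.cons_val, sub_zero]
      exact ⟨⟨h0, h1⟩, h 2, h 3⟩
    · rintro ⟨q, hq⟩ i
      rw [mem_preimage, mem_qball_inv p ha] at hq
      simp only [v, neg_add_eq_sub, Pi.sub_apply, Matrix.cons_val_zero, Matrix.cons_val_one,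
        Matrix.cons_val, sub_zero] at hq
      have key (u : ℚ_[p]) (n : ℕ) (h : ‖u - (n : ℚ_[p])‖ < 1) : ‖u‖ ≤ 1 := by
        have := Padic.nonarchimedean (u - (n : ℚ_[p])) (n : ℚ_[p])
        rw [sub_add_cancel] at this
        exact this.trans (max_le h.le (by simpa using Padic.norm_int_le_one (p := p) n))
      fin_cases i
      · exact key _ _ hq.1.1
      · exact key _ _ hq.1.2
      · exact hq.2.1
      · exact hq.2.2
  have hd : Pairwise (Function.onFun Disjoint
      fun q : Fin p × Fin p => (fun y => -v q + y) ⁻¹' qball p a (p : ℝ)⁻¹) := by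
    intro q q' hne
    refine Set.disjoint_left.2 fun y hy hy' => hne ?_
    rw [mem_preimage, mem_qball_inv p ha] at hy hy'
    simp only [v, neg_add_eq_sub, Pi.sub_apply, Matrix.cons_val_zero, Matrix.cons_val_one] at hy hy'
    have key (u : ℚ_[p]) (n m : Fin p) (h : ‖u - ((n : ℕ) : ℚ_[p])‖ < 1)
        (h' : ‖u - ((m : ℕ) : ℚ_[p])‖ < 1) : n = m := by
      have h2 : ‖(((n : ℕ) - (m : ℕ) : ℤ) : ℚ_[p])‖ < 1 := by
        have := Padic.nonarchimedean (u - ((m : ℕ) : ℚ_[p])) (-(u - ((n : ℕ) : ℚ_[p])))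
        rw [norm_neg, show u - ((m : ℕ) : ℚ_[p]) + -(u - ((n : ℕ) : ℚ_[p])) =
          ((n : ℕ) - (m : ℕ) : ℚ_[p]) by ring] at this
        push_cast
        exact this.trans_lt (max_lt h' h)
      rw [Padic.norm_intCast_lt_one_iff] at h2
      have := Int.eq_zero_of_abs_lt_dvd h2 (by rw [abs_lt]; omega)
      omega
    exact Prod.ext (key _ _ _ hy.1.1 hy'.1.1) (key _ _ _ hy.1.2 hy'.1.2)
  rw [hU, measure_iUnion hd fun q => (measurableSet_qball p a _).preimage (by fun_prop)]
  simp only [measure_preimage_add]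
  rw [tsum_fintype, Finset.sum_const, nsmul_eq_mul]
  simp [sq]

lemma measure_qball {a : ℤ} (ha : IsQNR p a) (hμ : μ {x : V p | ‖x‖ ≤ 1} = 1) (n : ℤ) :
    μ (qball p a ((p : ℝ) ^ n)) = ENNReal.ofReal ((p : ℝ) ^ (2 * n)) := by
  have hp0 := cast_pos p
  have hpe : (p : ℝ≥0∞) ≠ 0 := by exact_mod_cast (Fact.out : p.Prime).ne_zero
  obtain ⟨c, hc⟩ := exists_measure_qball_mul p μ a
  have h1 : μ (qball p a 1) = 1 := by rw [qball_one p ha, hμ]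
  have h2 := measure_qball_one_eq p μ ha
  have h3 := hc (p : ℝ)⁻¹
  rw [mul_inv_cancel₀ hp0.ne', h2] at h3
  rw [h1] at h2
  have hb0 : μ (qball p a (p : ℝ)⁻¹) ≠ 0 := by
    intro h; simp [h] at h2
  have hbt : μ (qball p a (p : ℝ)⁻¹) ≠ ⊤ := by
    intro h
    rw [h, ENNReal.mul_top (by simp [hpe])] at h2
    simp at h2
  have hce : c = (p : ℝ≥0∞) ^ 2 := ((ENNReal.mul_left_inj hb0 hbt).1 h3).symm
  have hstep (n : ℤ) : μ (qball p a ((p : ℝ) ^ (n + 1))) =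
      (p : ℝ≥0∞) ^ 2 * μ (qball p a ((p : ℝ) ^ n)) := by
    rw [zpow_add_one₀ hp0.ne', mul_comm, hc, hce]
  have hR (n : ℤ) : ENNReal.ofReal ((p : ℝ) ^ (2 * (n + 1))) =
      (p : ℝ≥0∞) ^ 2 * ENNReal.ofReal ((p : ℝ) ^ (2 * n)) := by
    rw [show 2 * (n + 1) = 2 + 2 * n by ring, zpow_add₀ hp0.ne', ENNReal.ofReal_mul (by positivity)]
    congr 1
    rw [zpow_ofNat, ENNReal.ofReal_pow hp0.le, ENNReal.ofReal_natCast]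
  have hq0 : (p : ℝ≥0∞) ^ 2 ≠ 0 := by simp [hpe]
  have hqt : (p : ℝ≥0∞) ^ 2 ≠ ⊤ := by simp
  induction n using Int.induction_on with
  | zero => simp [h1]
  | succ n ih => rw [hstep, ih, hR]
  | pred n ih =>
    rw [show -(n : ℤ) = (-(n : ℤ) - 1) + 1 by ring, hstep, hR] at ih
    exact (ENNReal.mul_right_inj hq0 hqt).1 ih

/-- Reversing the coordinates preserves Haar measure. -/
lemma measurePreserving_comp_rev {a : ℤ} (ha : IsQNR p a) (hμ : μ {x : V p | ‖x‖ ≤ 1} = 1) :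
    MeasurePreserving (fun x : V p => x ∘ Fin.rev) μ μ := by
  let e : V p ≃ₜ+ V p :=
    { toFun := fun x => x ∘ Fin.rev
      invFun := fun x => x ∘ Fin.rev
      left_inv := fun x => by ext i; simp
      right_inv := fun x => by ext i; simp
      map_add' := fun x y => rfl
      continuous_toFun := by fun_prop
      continuous_invFun := by fun_prop }
  have := e.isAddHaarMeasure_map μ
  refine ⟨e.continuous.measurable, ?_⟩
  change μ.map e = μ
  have h := Measure.isAddLeftInvariant_eq_smul (μ.map e) μ
  have hm : MeasurableSet {x : V p | ‖x‖ ≤ 1} := by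
    rw [← qball_one p ha]; exact measurableSet_qball p a 1
  have hpre : e ⁻¹' {x : V p | ‖x‖ ≤ 1} = {x : V p | ‖x‖ ≤ 1} := by
    ext x
    change ‖x ∘ Fin.rev‖ ≤ 1 ↔ ‖x‖ ≤ 1
    rw [pi_norm_le_iff_of_nonneg zero_le_one, pi_norm_le_iff_of_nonneg zero_le_one]
    exact Fin.revPerm.forall_congr_left (p := fun i => ‖(x ∘ Fin.rev) i‖ ≤ 1) |>.trans (by simp)
  have h2 := congr_arg (fun ν : Measure (V p) => ν {x : V p | ‖x‖ ≤ 1}) h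
  rw [Measure.map_apply (show Measurable e from e.continuous.measurable) hm, hpre,
    Measure.smul_apply, hμ] at h2
  have h3 : (μ.map e).addHaarScalarFactor μ = 1 := by
    have : (1 : ℝ≥0∞) = ((μ.map e).addHaarScalarFactor μ : ℝ≥0∞) := by
      simpa [ENNReal.smul_def] using h2
    exact_mod_cast this.symm
  rw [h, h3, one_smul]

end Measure

lemma hasSum_zpow_Iic {r : ℝ} (hr : 1 < r) (n : ℤ) :
    HasSum (fun k : ℤ => if k ≤ n then r ^ k else 0) (r ^ n * (1 - r⁻¹)⁻¹) := by
  have hr0 : 0 < r := one_pos.trans hr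
  have hinj : Function.Injective fun j : ℕ => n - (j : ℤ) := fun i j h => by
    have h' : n - (i : ℤ) = n - (j : ℤ) := h
    omega
  rw [← hinj.hasSum_iff]
  · have h := (hasSum_geometric_of_lt_one (inv_nonneg.2 hr0.le) (inv_lt_one_of_one_lt₀ hr)).mul_left
      (r ^ n)
    refine (congrArg (HasSum · _) (funext fun j => ?_)).mpr h
    simp [zpow_sub₀ hr0.ne', div_eq_mul_inv]
  · intro k hk
    refine if_neg fun hle => hk ⟨(n - k).toNat, ?_⟩
    change n - ((n - k).toNat : ℤ) = k
    omega

lemma integrable_of_hasSum {X E ι : Type*} [MeasurableSpace X] {μ : Measure X}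
    [NormedAddCommGroup E] [Countable ι] {F : ι → X → E} {f : X → E}
    (hF : ∀ i, Integrable (F i) μ) (hs : Summable fun i => ∫ y, ‖F i y‖ ∂μ)
    (hf : AEStronglyMeasurable f μ) (hsum : ∀ y, HasSum (fun i => F i y) (f y)) :
    Integrable f μ := by
  refine ⟨hf, ?_⟩
  calc ∫⁻ y, ‖f y‖ₑ ∂μ ≤ ∫⁻ y, ∑' i, ‖F i y‖ₑ ∂μ := by
        refine lintegral_mono fun y => ?_
        rw [← (hsum y).tsum_eq]
        exact enorm_tsum_le_tsum_enorm
    _ = ∑' i, ENNReal.ofReal (∫ y, ‖F i y‖ ∂μ) := by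
        rw [lintegral_tsum fun i => (hF i).1.enorm]
        exact tsum_congr fun i => (ofReal_integral_norm_eq_lintegral_enorm (hF i)).symm
    _ < ⊤ := hs.tsum_ofReal_lt_top

/-- The jump of `r ↦ r^(-α-2)` at `r = p^(-k)`, so that `|f|^(-α-2)` is a sum of these weights
over the balls `{|f| ≤ p^(-k)}`. -/
def ballWeight (α : ℝ) (k : ℤ) : ℝ := (1 - (p : ℝ) ^ (-α - 2)) * ((p : ℝ) ^ (α + 2)) ^ k

lemma one_sub_rpow_pos {α : ℝ} (hα : 0 < α) : 0 < 1 - (p : ℝ) ^ (-α - 2) :=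
  sub_pos.2 (Real.rpow_lt_one_of_one_lt_of_neg (one_lt_cast p) (by linarith))

lemma ballWeight_pos {α : ℝ} (hα : 0 < α) (k : ℤ) : 0 < ballWeight p α k := by
  have := cast_pos p
  exact mul_pos (one_sub_rpow_pos p hα) (by positivity)

lemma ballWeight_mul (α : ℝ) (k : ℤ) :
    ballWeight p α k * (p : ℝ) ^ (-(2 * k)) = (1 - (p : ℝ) ^ (-α - 2)) * ((p : ℝ) ^ α) ^ k := by
  have hp0 := cast_pos p
  rw [ballWeight, mul_assoc, Real.rpow_add hp0, mul_zpow, zpow_neg, zpow_mul]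
  congr 1
  rw [show ((p : ℝ) ^ (2 : ℝ)) = (p : ℝ) ^ (2 : ℤ) by norm_cast, mul_assoc, mul_inv_cancel₀,
    mul_one]
  positivity

lemma hasSum_ballWeight {a : ℤ} {α : ℝ} (hα : 0 < α) {y : V p} (hy : ‖qf p a y‖ ≠ 0) :
    HasSum (fun k : ℤ => (qball p a ((p : ℝ) ^ (-k))).indicator (fun _ => ballWeight p α k) y)
      (‖qf p a y‖ ^ (-α - 2)) := by
  have hp0 := cast_pos p
  have hp1 := one_lt_cast p
  obtain ⟨n, hn⟩ := norm_qf_eq_zpow p hy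
  have hr : 1 < (p : ℝ) ^ (α + 2) := Real.one_lt_rpow hp1 (by linarith)
  have h := (hasSum_zpow_Iic hr (-n)).mul_left (1 - (p : ℝ) ^ (-α - 2))
  have hinv : ((p : ℝ) ^ (α + 2))⁻¹ = (p : ℝ) ^ (-α - 2) := by
    rw [← Real.rpow_neg hp0.le]; congr 1; ring
  have hsum : ‖qf p a y‖ ^ (-α - 2) = (1 - (p : ℝ) ^ (-α - 2)) *
      (((p : ℝ) ^ (α + 2)) ^ (-n) * (1 - ((p : ℝ) ^ (α + 2))⁻¹)⁻¹) := by
    rw [hinv, mul_left_comm, mul_inv_cancel₀ (one_sub_rpow_pos p hα).ne', mul_one, hn,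
      ← Real.rpow_intCast, ← Real.rpow_mul hp0.le, ← Real.rpow_intCast, ← Real.rpow_mul hp0.le]
    congr 1
    push_cast
    ring
  rw [hsum]
  refine (congrArg (HasSum · _) (funext fun k => ?_)).mpr h
  have hiff : y ∈ qball p a ((p : ℝ) ^ (-k)) ↔ k ≤ -n := by
    rw [qball, mem_ofPred_eq, hn, zpow_le_zpow_iff_right₀ hp1]
    omega
  by_cases hk : k ≤ -n
  · rw [indicator_of_mem (hiff.2 hk), if_pos hk, ballWeight]
  · rw [indicator_of_notMem (mt hiff.1 hk), if_neg hk, mul_zero]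

lemma qball_mono (a : ℤ) {r s : ℝ} (h : r ≤ s) : qball p a r ⊆ qball p a s :=
  fun _ hy => le_trans hy h

section KernelIntegral

variable {a : ℤ} {α : ℝ} {E : Type*} [NormedAddCommGroup E] [NormedSpace ℝ E]
  {μ : Measure (V p)} [μ.IsAddHaarMeasure]

/-- Integration of a bounded function that vanishes near the origin against `|f|^(-α-2)`. -/
lemma kernel_integral (ha : IsQNR p a) (hμ : μ {x : V p | ‖x‖ ≤ 1} = 1) (hα : 0 < α)
    {g : V p → E} (hg : AEStronglyMeasurable g μ) (hb : ∀ y, ‖g y‖ ≤ 2) {m : ℤ}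
    (hm : ∀ y ∈ qball p a ((p : ℝ) ^ (-m)), g y = 0) :
    Integrable (fun y => ‖qf p a y‖ ^ (-α - 2) • g y) μ ∧
    HasSum (fun k : ℤ => ballWeight p α k • ∫ y in qball p a ((p : ℝ) ^ (-k)), g y ∂μ)
      (∫ y, ‖qf p a y‖ ^ (-α - 2) • g y ∂μ) ∧
    ‖∫ y, ‖qf p a y‖ ^ (-α - 2) • g y ∂μ‖ ≤
      2 * ((1 - (p : ℝ) ^ (-α - 2)) * (((p : ℝ) ^ α) ^ (m - 1) * (1 - ((p : ℝ) ^ α)⁻¹)⁻¹)) := by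
  have hp0 := cast_pos p
  have hp1 := one_lt_cast p
  have hvol (k : ℤ) := measure_qball p μ ha hμ (-k)
  have hfin (k : ℤ) : μ (qball p a ((p : ℝ) ^ (-k))) < ⊤ := by
    rw [hvol]; exact ENNReal.ofReal_lt_top
  have hreal (k : ℤ) : μ.real (qball p a ((p : ℝ) ^ (-k))) = (p : ℝ) ^ (-(2 * k)) := by
    rw [Measure.real, hvol, ENNReal.toReal_ofReal (by positivity)]
    congr 1; ring
  have hmeas (k : ℤ) := measurableSet_qball p a ((p : ℝ) ^ (-k))
  let F : ℤ → V p → E := fun k y =>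
    ballWeight p α k • (qball p a ((p : ℝ) ^ (-k))).indicator g y
  have hF (k : ℤ) : Integrable (F k) μ :=
    ((integrable_indicator_iff (hmeas k)).2 (Measure.integrableOn_of_bounded (hfin k).ne hg
      (Filter.Eventually.of_forall hb))).smul _
  have hpt (y : V p) : HasSum (fun k => F k y) (‖qf p a y‖ ^ (-α - 2) • g y) := by
    by_cases hy : ‖qf p a y‖ = 0
    · have hgy : g y = 0 := hm y (by rw [qball, mem_ofPred_eq, hy]; positivity)
      have : (fun k => F k y) = fun _ => 0 := by
        ext k
        simp only [F]
        rw [indicator_apply_eq_zero.2 fun _ => hgy, smul_zero]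
      rw [this, hgy, smul_zero]
      exact hasSum_zero
    · convert (hasSum_ballWeight p hα hy).smul_const (g y) using 2 with k
      simp only [F]
      by_cases h : y ∈ qball p a ((p : ℝ) ^ (-k))
      · rw [indicator_of_mem h, indicator_of_mem h]
      · rw [indicator_of_notMem h, indicator_of_notMem h, smul_zero, zero_smul]
  have hnorm (k : ℤ) : ∫ y, ‖F k y‖ ∂μ =
      ballWeight p α k * ∫ y in qball p a ((p : ℝ) ^ (-k)), ‖g y‖ ∂μ := by
    rw [← integral_indicator (hmeas k), ← integral_const_mul]
    refine integral_congr_ae (Filter.Eventually.of_forall fun y => ?_)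
    simp only [F]
    rw [norm_smul, Real.norm_of_nonneg (ballWeight_pos p hα k).le, norm_indicator_eq_indicator_norm]
  have hFi (k : ℤ) : ∫ y, F k y ∂μ =
      ballWeight p α k • ∫ y in qball p a ((p : ℝ) ^ (-k)), g y ∂μ := by
    simp only [F]
    rw [integral_smul, integral_indicator (hmeas k)]
  have hq : 1 < (p : ℝ) ^ α := Real.one_lt_rpow hp1 hα
  have hB := ((hasSum_zpow_Iic hq (m - 1)).mul_left (1 - (p : ℝ) ^ (-α - 2))).mul_left 2
  have hle (k : ℤ) : ∫ y, ‖F k y‖ ∂μ ≤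
      2 * ((1 - (p : ℝ) ^ (-α - 2)) * if k ≤ m - 1 then ((p : ℝ) ^ α) ^ k else 0) := by
    rw [hnorm]
    split_ifs with hk
    · rw [← ballWeight_mul, mul_left_comm]
      refine mul_le_mul_of_nonneg_left ?_ (ballWeight_pos p hα k).le
      rw [← hreal]
      exact (le_abs_self _).trans (norm_setIntegral_le_of_norm_le_const (hfin k)
        fun y _ => (norm_norm (g y)).trans_le (hb y))
    · rw [setIntegral_congr_fun (g := fun _ => (0 : ℝ)) (hmeas k)]
      · simp
      · intro y hy
        have : y ∈ qball p a ((p : ℝ) ^ (-m)) :=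
          qball_mono p a (zpow_le_zpow_right₀ hp1.le (by omega)) hy
        simp [hm y this]
  have hsum : Summable fun k => ∫ y, ‖F k y‖ ∂μ :=
    .of_nonneg_of_le (fun k => integral_nonneg fun y => norm_nonneg _) hle hB.summable
  have hmain : HasSum (fun k => ∫ y, F k y ∂μ) (∫ y, ‖qf p a y‖ ^ (-α - 2) • g y ∂μ) := by
    convert hasSum_integral_of_summable_integral_norm hF hsum using 1
    exact integral_congr_ae (Filter.Eventually.of_forall fun y => (hpt y).tsum_eq.symm)
  refine ⟨integrable_of_hasSum hF hsum ?_ hpt, ?_,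
    hmain.norm_le_of_bounded hB fun k => (norm_integral_le_integral_norm _).trans (hle k)⟩
  · exact (((continuous_qf p a).norm.measurable.pow_const _).aestronglyMeasurable).smul hg
  · simpa only [hFi] using hmain

end KernelIntegral

section Symbol

variable {p} {a : ℤ} {α : ℝ} {μ : Measure (V p)} [μ.IsAddHaarMeasure] {χ : ℚ_[p] → ℂ}

lemma IsStdChar.continuous_dot (hχ : IsStdChar p χ) (ξ : V p) :
    Continuous fun y : V p => χ (∑ i, ξ i * y i) :=
  hχ.1.comp (by fun_prop)

lemma IsStdChar.setIntegral_qball (hχ : IsStdChar p χ) (ha : IsQNR p a)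
    (hμ : μ {x : V p | ‖x‖ ≤ 1} = 1) (ξ : V p) (k : ℤ) :
    ∫ y in qball p a ((p : ℝ) ^ (-k)), (χ (∑ i, ξ i * y i) - 1) ∂μ =
      if ‖qfc p a ξ‖ ≤ (p : ℝ) ^ k then 0 else -(((p : ℝ) ^ (-(2 * k)) : ℝ) : ℂ) := by
  have hp0 := cast_pos p
  have hvol := measure_qball p μ ha hμ (-k)
  have hmeas := measurableSet_qball p a ((p : ℝ) ^ (-k))
  have hfin : μ (qball p a ((p : ℝ) ^ (-k))) ≠ ⊤ := by
    rw [hvol]; exact ENNReal.ofReal_ne_top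
  split_ifs with h
  · rw [setIntegral_congr_fun (g := fun _ => (0 : ℂ)) hmeas]
    · simp
    · intro y hy
      simp [hχ.eq_one_of_norm_le_one (norm_dot_le_one p ha h hy)]
  · obtain ⟨z, hz, hdot⟩ := exists_dot_eq_inv p ha (not_le.1 h)
    have hz' : ‖qf p a (-z)‖ ≤ (p : ℝ) ^ (-k) := by rwa [qf_neg]
    set B := qball p a ((p : ℝ) ^ (-k)) with hB
    have hI : ∫ y in B, χ (∑ i, ξ i * y i) ∂μ = 0 := by
      have h1 := integral_add_right_eq_self (μ := μ)
        (B.indicator fun y : V p => χ (∑ i, ξ i * y i)) z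
      have h2 (y : V p) : B.indicator (fun y : V p => χ (∑ i, ξ i * y i)) (y + z) =
          χ (p : ℚ_[p])⁻¹ * B.indicator (fun y : V p => χ (∑ i, ξ i * y i)) y := by
        have hiff : y + z ∈ B ↔ y ∈ B := by
          constructor
          · intro hy
            have := norm_qf_add_le p ha hy hz'
            rwa [add_neg_cancel_right] at this
          · intro hy
            exact norm_qf_add_le p ha hy hz
        by_cases hy : y ∈ B
        · rw [indicator_of_mem (hiff.2 hy), indicator_of_mem hy]
          simp only [Pi.add_apply, mul_add, Finset.sum_add_distrib]
          rw [hχ.map_add, hdot, mul_comm]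
        · rw [indicator_of_notMem (mt hiff.1 hy), indicator_of_notMem hy, mul_zero]
      simp only [h2] at h1
      rw [integral_const_mul, integral_indicator hmeas] at h1
      have h3 : (χ (p : ℚ_[p])⁻¹ - 1) * ∫ y in B, χ (∑ i, ξ i * y i) ∂μ = 0 := by
        rw [sub_mul, h1, one_mul, sub_self]
      exact (mul_eq_zero.1 h3).resolve_left (sub_ne_zero.2 hχ.inv_prime_ne_one)
    have hFi : IntegrableOn (fun y : V p => χ (∑ i, ξ i * y i)) B μ :=
      Measure.integrableOn_of_bounded hfin (hχ.continuous_dot ξ).aestronglyMeasurable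
        (M := 1) (Filter.Eventually.of_forall fun y => (hχ.norm_eq_one _).le)
    rw [integral_sub hFi (integrableOn_const hfin), hI, setIntegral_const, Measure.real, hvol,
      ENNReal.toReal_ofReal (by positivity)]
    simp

lemma IsStdChar.norm_sub_one_le (hχ : IsStdChar p χ) (x : ℚ_[p]) : ‖χ x - 1‖ ≤ 2 := by
  refine (norm_sub_le _ _).trans ?_
  rw [hχ.norm_eq_one, norm_one]
  norm_num

lemma IsStdChar.eq_one_of_qfc_eq_zero (hχ : IsStdChar p χ) (ha : IsQNR p a) {ξ : V p}
    (h : ‖qfc p a ξ‖ = 0) (y : V p) : χ (∑ i, ξ i * y i) = 1 := by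
  have hp0 := cast_pos p
  obtain ⟨n, hn⟩ : ∃ n : ℤ, ‖qf p a y‖ ≤ (p : ℝ) ^ (-n) := by
    by_cases hy : ‖qf p a y‖ = 0
    · exact ⟨0, by simp [hy]⟩
    · obtain ⟨n, hn⟩ := norm_qf_eq_zpow p hy
      exact ⟨-n, by rw [hn, neg_neg]⟩
  exact hχ.eq_one_of_norm_le_one (norm_dot_le_one p ha (by rw [h]; positivity) hn)

/-- The symbol of `f(∂,α)` is `|f°(ξ)|^α`. -/
lemma IsStdChar.symbol_eq (hχ : IsStdChar p χ) (ha : IsQNR p a)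
    (hμ : μ {x : V p | ‖x‖ ≤ 1} = 1) (hα : 0 < α) (ξ : V p) :
    (((1 - (p : ℝ) ^ α) / (1 - (p : ℝ) ^ (-α - 2)) : ℝ) : ℂ) *
      ∫ y, (χ (∑ i, ξ i * y i) - 1) * ((‖qf p a y‖ ^ (-α - 2) : ℝ) : ℂ) ∂μ =
      ((‖qfc p a ξ‖ ^ α : ℝ) : ℂ) := by
  have hp0 := cast_pos p
  have hp1 := one_lt_cast p
  by_cases h0 : ‖qfc p a ξ‖ = 0
  · simp [hχ.eq_one_of_qfc_eq_zero ha h0, h0, Real.zero_rpow hα.ne']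
  obtain ⟨m, hm⟩ : ∃ m : ℤ, ‖qfc p a ξ‖ = (p : ℝ) ^ m := by
    rw [qfc_eq_qf_comp_rev] at h0 ⊢
    exact norm_qf_eq_zpow p h0
  have hk := (kernel_integral p ha hμ hα (g := fun y => χ (∑ i, ξ i * y i) - 1)
    ((hχ.continuous_dot ξ).sub continuous_const).aestronglyMeasurable
    (fun y => hχ.norm_sub_one_le _) (m := m) (fun y hy => by
      simp [hχ.eq_one_of_norm_le_one (norm_dot_le_one p ha hm.le hy)])).2.1
  have hq : 1 < (p : ℝ) ^ α := Real.one_lt_rpow hp1 hα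
  have hB := ((hasSum_zpow_Iic hq (m - 1)).mul_left (1 - (p : ℝ) ^ (-α - 2))).neg
  have hB' := Complex.hasSum_ofReal.2 hB
  have e : (fun k : ℤ => ballWeight p α k • ∫ y in qball p a ((p : ℝ) ^ (-k)),
      (χ (∑ i, ξ i * y i) - 1) ∂μ) = fun k => ((-((1 - (p : ℝ) ^ (-α - 2)) *
        if k ≤ m - 1 then ((p : ℝ) ^ α) ^ k else 0) : ℝ) : ℂ) := by
    ext k
    have hiff : ‖qfc p a ξ‖ ≤ (p : ℝ) ^ k ↔ m ≤ k := by rw [hm, zpow_le_zpow_iff_right₀ hp1]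
    rw [hχ.setIntegral_qball ha hμ]
    by_cases hmk : m ≤ k
    · rw [if_pos (hiff.2 hmk), if_neg (by omega)]
      simp
    · rw [if_neg (mt hiff.1 hmk), if_pos (by omega), ← ballWeight_mul]
      simp
  rw [e] at hk
  have heq := hk.unique hB'
  have hcomm : ∫ y, (χ (∑ i, ξ i * y i) - 1) * ((‖qf p a y‖ ^ (-α - 2) : ℝ) : ℂ) ∂μ =
      ∫ y, ‖qf p a y‖ ^ (-α - 2) • (χ (∑ i, ξ i * y i) - 1) ∂μ := by
    refine integral_congr_ae (Filter.Eventually.of_forall fun y => ?_)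
    simp only [Complex.real_smul]
    ring
  rw [hcomm, heq, ← Complex.ofReal_mul]
  congr 1
  have hw := (one_sub_rpow_pos p hα).ne'
  have hA : ((p : ℝ) ^ m) ^ α = ((p : ℝ) ^ α) ^ m := by
    rw [← Real.rpow_intCast, ← Real.rpow_mul hp0.le, mul_comm, Real.rpow_mul hp0.le,
      Real.rpow_intCast]
  rw [hm, hA, zpow_sub_one₀ (by positivity)]
  have hq1 : (p : ℝ) ^ α - 1 ≠ 0 := by linarith
  generalize (p : ℝ) ^ α = q at *
  have hq0 : q ≠ 0 := by linarith
  have : 1 - q⁻¹ = (q - 1) / q := by field_simp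
  rw [this]
  generalize 1 - (p : ℝ) ^ (-α - 2) = w at *
  field_simp
  ring

lemma IsStdChar.integrable_kernel (hχ : IsStdChar p χ) (ha : IsQNR p a)
    (hμ : μ {x : V p | ‖x‖ ≤ 1} = 1) (hα : 0 < α) (ξ : V p) :
    Integrable (fun y => (χ (∑ i, ξ i * y i) - 1) * ((‖qf p a y‖ ^ (-α - 2) : ℝ) : ℂ)) μ ∧
    ∫ y, ‖(χ (∑ i, ξ i * y i) - 1) * ((‖qf p a y‖ ^ (-α - 2) : ℝ) : ℂ)‖ ∂μ ≤
      2 * ((1 - (p : ℝ) ^ (-α - 2)) * (((p : ℝ) ^ α)⁻¹ * (1 - ((p : ℝ) ^ α)⁻¹)⁻¹)) *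
        ‖qfc p a ξ‖ ^ α := by
  have hp0 := cast_pos p
  have hp1 := one_lt_cast p
  by_cases h0 : ‖qfc p a ξ‖ = 0
  · simp [hχ.eq_one_of_qfc_eq_zero ha h0, h0, Real.zero_rpow hα.ne']
  obtain ⟨m, hm⟩ : ∃ m : ℤ, ‖qfc p a ξ‖ = (p : ℝ) ^ m := by
    rw [qfc_eq_qf_comp_rev] at h0 ⊢
    exact norm_qf_eq_zpow p h0
  have hz (y : V p) (hy : y ∈ qball p a ((p : ℝ) ^ (-m))) : χ (∑ i, ξ i * y i) - 1 = 0 := by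
    simp [hχ.eq_one_of_norm_le_one (norm_dot_le_one p ha hm.le hy)]
  have hc : Continuous fun y : V p => χ (∑ i, ξ i * y i) - 1 :=
    (hχ.continuous_dot ξ).sub continuous_const
  have hk := (kernel_integral p ha hμ hα hc.aestronglyMeasurable
    (fun y => hχ.norm_sub_one_le _) hz).1
  have hk' := (kernel_integral p ha hμ hα hc.norm.aestronglyMeasurable
    (fun y => by rw [norm_norm]; exact hχ.norm_sub_one_le _) (m := m)
    (fun y hy => by rw [hz y hy, norm_zero])).2.2
  have e (y : V p) : (χ (∑ i, ξ i * y i) - 1) * ((‖qf p a y‖ ^ (-α - 2) : ℝ) : ℂ) =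
      ‖qf p a y‖ ^ (-α - 2) • (χ (∑ i, ξ i * y i) - 1) := by
    rw [Complex.real_smul, mul_comm]
  simp only [e]
  refine ⟨hk, ?_⟩
  have hA : ((p : ℝ) ^ m) ^ α = ((p : ℝ) ^ α) ^ m := by
    rw [← Real.rpow_intCast, ← Real.rpow_mul hp0.le, mul_comm, Real.rpow_mul hp0.le,
      Real.rpow_intCast]
  rw [hm, hA]
  have e2 (y : V p) : ‖‖qf p a y‖ ^ (-α - 2) • (χ (∑ i, ξ i * y i) - 1)‖ =
      ‖qf p a y‖ ^ (-α - 2) • ‖χ (∑ i, ξ i * y i) - 1‖ := by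
    rw [norm_smul, Real.norm_of_nonneg (by positivity), smul_eq_mul]
  simp only [e2]
  refine (le_abs_self _).trans (hk'.trans (le_of_eq ?_))
  rw [zpow_sub_one₀ (by positivity)]
  ring

end Symbol

section HeatKernel

variable {p} {a : ℤ} {α : ℝ} {μ : Measure (V p)} [μ.IsAddHaarMeasure] {χ : ℚ_[p] → ℂ}

lemma integrable_exp_neg_qf (ha : IsQNR p a) (hμ : μ {x : V p | ‖x‖ ≤ 1} = 1) (hα : 0 < α)
    {c : ℝ} (hc : 0 < c) : Integrable (fun y : V p => Real.exp (-(c * ‖qf p a y‖ ^ α))) μ := by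
  obtain ⟨n, hn⟩ := exists_nat_gt (2 / α)
  rw [div_lt_iff₀ hα] at hn
  have hmeas := measurableSet_qball p a 1
  have hvol : μ (qball p a 1) ≠ ⊤ := by
    have h := measure_qball p μ ha hμ 0
    rw [zpow_zero] at h
    rw [h]
    exact ENNReal.ofReal_ne_top
  have h1 : Integrable ((qball p a 1).indicator fun _ => (1 : ℝ)) μ :=
    (integrable_indicator_iff hmeas).2 (integrableOn_const hvol)
  have h2 := (kernel_integral p ha hμ (α := n * α - 2) (by linarith)
    (g := (qball p a 1)ᶜ.indicator fun _ => (1 : ℝ)) (m := 0)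
    ((measurable_const.indicator hmeas.compl).aestronglyMeasurable)
    (fun y => (norm_indicator_le_norm_self _ _).trans (by norm_num))
    (fun y hy => indicator_of_notMem (notMem_compl_iff.2 (by simpa using hy)) _)).1
  have hcont : Continuous fun y : V p => Real.exp (-(c * ‖qf p a y‖ ^ α)) :=
    Real.continuous_exp.comp
      (((continuous_qf p a).norm.rpow_const fun _ => Or.inr hα.le).const_mul c).neg
  refine (h1.add (h2.const_mul (n.factorial / c ^ n))).mono' hcont.aestronglyMeasurable
    (Eventually.of_forall fun y => ?_)
  rw [Real.norm_of_nonneg (Real.exp_pos _).le, Pi.add_apply]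
  by_cases hy : y ∈ qball p a 1
  · rw [indicator_of_mem hy, indicator_of_notMem (notMem_compl_iff.2 hy), smul_zero, mul_zero,
      add_zero, Real.exp_le_one_iff, neg_nonpos]
    positivity
  · have hr : 0 < ‖qf p a y‖ := one_pos.trans (not_le.1 hy)
    have hu : 0 < c * ‖qf p a y‖ ^ α := by positivity
    rw [indicator_of_notMem hy, indicator_of_mem hy, zero_add, Real.exp_neg, smul_eq_mul, mul_one]
    calc (Real.exp (c * ‖qf p a y‖ ^ α))⁻¹
        ≤ ((c * ‖qf p a y‖ ^ α) ^ n / n.factorial)⁻¹ :=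
          inv_anti₀ (by positivity) (Real.pow_div_factorial_le_exp _ hu.le n)
      _ = n.factorial / c ^ n * ‖qf p a y‖ ^ (-(n * α - 2) - 2) := by
          rw [mul_pow, ← Real.rpow_mul_natCast hr.le,
            show -(n * α - 2) - 2 = -(α * n) by ring, Real.rpow_neg hr.le]
          field_simp

lemma integrable_exp_neg_qfc (ha : IsQNR p a) (hμ : μ {x : V p | ‖x‖ ≤ 1} = 1) (hα : 0 < α)
    {c : ℝ} (hc : 0 < c) : Integrable (fun ξ : V p => Real.exp (-(c * ‖qfc p a ξ‖ ^ α))) μ := by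
  simp only [qfc_eq_qf_comp_rev]
  exact (measurePreserving_comp_rev p μ ha hμ).integrable_comp_of_integrable
    (integrable_exp_neg_qf ha hμ hα hc)

lemma continuous_qfc_rpow (a : ℤ) (hα : 0 < α) : Continuous fun ξ : V p => ‖qfc p a ξ‖ ^ α :=
  (continuous_qfc p a).norm.rpow_const fun _ => Or.inr hα.le

lemma continuous_exp_neg_qfc (a : ℤ) (hα : 0 < α) (c : ℝ) :
    Continuous fun ξ : V p => Real.exp (-(c * ‖qfc p a ξ‖ ^ α)) :=
  Real.continuous_exp.comp ((continuous_qfc_rpow a hα).const_mul c).neg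

lemma integrable_qfc_mul_exp_neg (ha : IsQNR p a) (hμ : μ {x : V p | ‖x‖ ≤ 1} = 1) (hα : 0 < α)
    {c : ℝ} (hc : 0 < c) :
    Integrable (fun ξ : V p => ‖qfc p a ξ‖ ^ α * Real.exp (-(c * ‖qfc p a ξ‖ ^ α))) μ := by
  refine ((integrable_exp_neg_qfc ha hμ hα (half_pos hc)).const_mul (2 / c)).mono'
    ((continuous_qfc_rpow a hα).mul (continuous_exp_neg_qfc a hα c)).aestronglyMeasurable
    (Eventually.of_forall fun ξ => ?_)
  have hu : 0 ≤ ‖qfc p a ξ‖ ^ α := by positivity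
  rw [Real.norm_of_nonneg (by positivity)]
  generalize ‖qfc p a ξ‖ ^ α = u at *
  have h1 : c / 2 * u ≤ Real.exp (c / 2 * u) :=
    (le_add_of_nonneg_right zero_le_one).trans (Real.add_one_le_exp _)
  have h2 : u ≤ 2 / c * Real.exp (c / 2 * u) := by
    rw [div_mul_eq_mul_div, le_div_iff₀ hc]
    linarith
  calc u * Real.exp (-(c * u))
      ≤ 2 / c * Real.exp (c / 2 * u) * Real.exp (-(c * u)) := by gcongr
    _ = 2 / c * Real.exp (-(c / 2 * u)) := by
        rw [mul_assoc, ← Real.exp_add]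
        ring_nf

lemma IsStdChar.integrable_heat (hχ : IsStdChar p χ) (ha : IsQNR p a)
    (hμ : μ {x : V p | ‖x‖ ≤ 1} = 1) (hα : 0 < α) {c : ℝ} (hc : 0 < c) (x : V p) :
    Integrable (fun ξ : V p => χ (∑ i, ξ i * x i) *
      (Real.exp (-(c * ‖qfc p a ξ‖ ^ α)) : ℂ)) μ := by
  have hcont : Continuous fun ξ : V p => χ (∑ i, ξ i * x i) := hχ.1.comp (by fun_prop)
  exact (integrable_exp_neg_qfc ha hμ hα hc).ofReal.bdd_mul hcont.aestronglyMeasurable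
    (Eventually.of_forall fun ξ => (hχ.norm_eq_one _).le)

/-- Differentiation of the heat kernel under the integral sign. -/
lemma IsStdChar.hasDerivAt_heatZ (hχ : IsStdChar p χ) (ha : IsQNR p a)
    (hμ : μ {x : V p | ‖x‖ ≤ 1} = 1) {κ t : ℝ} (hκ : 0 < κ) (hα : 0 < α) (ht : 0 < t) (x : V p) :
    HasDerivAt (fun s => heatZ p μ χ a κ α x s)
      (∫ ξ, χ (∑ i, ξ i * x i) * ((-(κ * ‖qfc p a ξ‖ ^ α) *
        Real.exp (-(κ * t * ‖qfc p a ξ‖ ^ α)) : ℝ) : ℂ) ∂μ) t := by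
  have hcont : Continuous fun ξ : V p => χ (∑ i, ξ i * x i) := hχ.1.comp (by fun_prop)
  have hbound := (integrable_qfc_mul_exp_neg (μ := μ) ha hμ hα
    (mul_pos hκ (half_pos ht))).const_mul κ
  refine (hasDerivAt_integral_of_dominated_loc_of_deriv_le (𝕜 := ℝ)
    (F := fun s ξ => χ (∑ i, ξ i * x i) * (Real.exp (-(κ * s * ‖qfc p a ξ‖ ^ α)) : ℂ))
    (F' := fun s ξ => χ (∑ i, ξ i * x i) * ((-(κ * ‖qfc p a ξ‖ ^ α) *
      Real.exp (-(κ * s * ‖qfc p a ξ‖ ^ α)) : ℝ) : ℂ)) (Ioi_mem_nhds (half_lt_self ht))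
    (Eventually.of_forall fun s => ?_) ?_ ?_ (Eventually.of_forall fun ξ s hs => ?_) hbound
    (Eventually.of_forall fun ξ s _ => ?_)).2
  · exact (hcont.mul (Complex.continuous_ofReal.comp
      (continuous_exp_neg_qfc a hα (κ * s)))).aestronglyMeasurable
  · exact hχ.integrable_heat ha hμ hα (mul_pos hκ ht) x
  · exact (hcont.mul (Complex.continuous_ofReal.comp
      (((continuous_qfc_rpow a hα).const_mul κ).neg.mul
        (continuous_exp_neg_qfc a hα (κ * t))))).aestronglyMeasurable
  · rw [norm_mul, hχ.norm_eq_one, one_mul, Complex.norm_real, norm_mul, norm_neg,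
      Real.norm_of_nonneg (by positivity), Real.norm_of_nonneg (by positivity), mul_assoc]
    have hs' : t / 2 ≤ s := le_of_lt hs
    gcongr
  · have h : HasDerivAt (fun s => Real.exp (-(κ * s * ‖qfc p a ξ‖ ^ α)))
        (-(κ * ‖qfc p a ξ‖ ^ α) * Real.exp (-(κ * s * ‖qfc p a ξ‖ ^ α))) s := by
      have h := (((hasDerivAt_id s).const_mul κ).mul_const (‖qfc p a ξ‖ ^ α)).fun_neg.exp
      simp only [id, mul_one] at h
      rwa [mul_comm] at h
    exact h.ofReal_comp.const_mul _

/-- The heat kernel under `f(∂,α)`: the operator acts on the Fourier side as multiplication by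
its symbol. -/
lemma IsStdChar.fop_heatZ (hχ : IsStdChar p χ) (ha : IsQNR p a)
    (hμ : μ {x : V p | ‖x‖ ≤ 1} = 1) {κ t : ℝ} (hκ : 0 < κ) (hα : 0 < α) (ht : 0 < t) (x : V p) :
    fop p μ a α (fun y => heatZ p μ χ a κ α y t) x =
      ∫ ξ, χ (∑ i, ξ i * x i) * ((‖qfc p a ξ‖ ^ α *
        Real.exp (-(κ * t * ‖qfc p a ξ‖ ^ α)) : ℝ) : ℂ) ∂μ := by
  have hκt := mul_pos hκ ht
  let G : V p → V p → ℂ := fun ξ y => (χ (∑ i, ξ i * x i) *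
    (Real.exp (-(κ * t * ‖qfc p a ξ‖ ^ α)) : ℂ)) *
      ((χ (∑ i, (-ξ) i * y i) - 1) * ((‖qf p a y‖ ^ (-α - 2) : ℝ) : ℂ))
  have hZ (y : V p) : (heatZ p μ χ a κ α (x - y) t - heatZ p μ χ a κ α x t) *
      ((‖qf p a y‖ ^ (-α - 2) : ℝ) : ℂ) = ∫ ξ, G ξ y ∂μ := by
    rw [heatZ, heatZ, ← integral_sub (hχ.integrable_heat ha hμ hα hκt _)
      (hχ.integrable_heat ha hμ hα hκt _), ← integral_mul_const]
    refine integral_congr_ae (Eventually.of_forall fun ξ => ?_)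
    have h : ∑ i, ξ i * (x - y) i = ∑ i, ξ i * x i + ∑ i, (-ξ) i * y i := by
      rw [← Finset.sum_add_distrib]
      refine Finset.sum_congr rfl fun i _ => ?_
      rw [Pi.sub_apply, Pi.neg_apply]
      ring
    simp only [G]
    rw [h, hχ.map_add]
    ring
  have hGmeas : AEStronglyMeasurable (Function.uncurry G) (μ.prod μ) := by
    have h1 : Continuous fun z : V p × V p => χ (∑ i, z.1 i * x i) := hχ.1.comp (by fun_prop)
    have h2 : Continuous fun z : V p × V p =>
        (Real.exp (-(κ * t * ‖qfc p a z.1‖ ^ α)) : ℂ) :=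
      Complex.continuous_ofReal.comp ((continuous_exp_neg_qfc a hα _).comp continuous_fst)
    have h3 : Continuous fun z : V p × V p => χ (∑ i, (-z.1) i * z.2 i) - 1 :=
      (hχ.1.comp (by simp only [Pi.neg_apply]; fun_prop)).sub continuous_const
    have h4 : Measurable fun z : V p × V p => ((‖qf p a z.2‖ ^ (-α - 2) : ℝ) : ℂ) :=
      Complex.measurable_ofReal.comp
        (((continuous_qf p a).comp continuous_snd).norm.measurable.pow_const _)
    exact (h1.mul h2).aestronglyMeasurable.mul
      (h3.aestronglyMeasurable.mul h4.aestronglyMeasurable)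
  have hG : Integrable (Function.uncurry G) (μ.prod μ) := by
    refine (integrable_prod_iff hGmeas).2 ⟨Eventually.of_forall fun ξ => ?_, ?_⟩
    · simp only [Function.uncurry_apply_pair, G]
      exact (hχ.integrable_kernel ha hμ hα (-ξ)).1.const_mul _
    refine ((integrable_qfc_mul_exp_neg (μ := μ) ha hμ hα hκt).const_mul
      (2 * ((1 - (p : ℝ) ^ (-α - 2)) * (((p : ℝ) ^ α)⁻¹ * (1 - ((p : ℝ) ^ α)⁻¹)⁻¹)))).mono'
      hGmeas.norm.integral_prod_right' (Eventually.of_forall fun ξ => ?_)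
    have h := (hχ.integrable_kernel (μ := μ) ha hμ hα (-ξ)).2
    rw [Real.norm_of_nonneg (integral_nonneg fun y => norm_nonneg _)]
    simp only [Function.uncurry_apply_pair, G, norm_mul (_ * _) (_ * _)]
    rw [integral_const_mul, norm_mul (χ _), hχ.norm_eq_one, one_mul, Complex.norm_real,
      Real.norm_of_nonneg (Real.exp_pos _).le]
    rw [qfc_neg] at h
    calc _ ≤ _ := mul_le_mul_of_nonneg_left h (Real.exp_pos _).le
      _ = _ := by ring
  rw [fop]
  simp only [hZ]
  rw [integral_integral_swap (f := fun y ξ => G ξ y) hG.swap, ← integral_const_mul]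
  refine integral_congr_ae (Eventually.of_forall fun ξ => ?_)
  simp only [G]
  rw [integral_const_mul, mul_left_comm, hχ.symbol_eq ha hμ hα, qfc_neg, Complex.ofReal_mul]
  ring

end HeatKernel

/-- for every `x ∈ ℚ_p⁴` and `t > 0`,
`∂Z(x,t)/∂t = −κ (f(∂,α)Z_t)(x)`, i.e. the heat kernel solves `∂Z/∂t + κ f(∂,α)Z = 0`. -/
theorem statement10
    (hp : p ≠ 2) (a : ℤ) (ha : IsQNR p a)
    (μ : Measure (V p)) [μ.IsAddHaarMeasure] (hμ : μ {x : V p | ‖x‖ ≤ 1} = 1)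
    (χ : ℚ_[p] → ℂ) (hχ : IsStdChar p χ)
    (κ α : ℝ) (hκ : 0 < κ) (hα : 0 < α) (x : V p) (t : ℝ) (ht : 0 < t) :
    deriv (fun s => heatZ p μ χ a κ α x s) t =
      -(κ : ℂ) * fop p μ a α (fun y => heatZ p μ χ a κ α y t) x := by
  rw [(hχ.hasDerivAt_heatZ ha hμ hκ hα ht x).deriv, hχ.fop_heatZ ha hμ hκ hα ht x,
    ← integral_const_mul]
  refine integral_congr_ae (Eventually.of_forall fun ξ => ?_)
  push_cast
  ring

end PadicParabolic
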